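/- arXiv:0901.1368 — 2 statements merged into one kernel-verified Lean document; each statement's English description precedes it below -/
import Mathlib

section
/- Let α ∈ (0,1) and ω : [0,∞) → [0,∞) a modulus of continuity with ∫₁^∞ ω(η)/η^{1+α} dη < ∞. If θ : ℝ² → ℝ has modulus of continuity ω, then u = |D|^{α−1} R^⊥ θ has modulus of continuity Ω(ξ) = A_α ( ∫₀^ξ ω(η)/η^α dη + ξ ∫_ξ^∞ ω(η)/η^{1+α} dη ) for some constant A_α depending only on α. -/
open MeasureTheory Set Metric Filter

/-- The rotated vector y^⊥ = (−y₂, y₁) in ℝ². -/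
noncomputable def perpVec (y : EuclideanSpace ℝ (Fin 2)) : EuclideanSpace ℝ (Fin 2) :=
  (WithLp.equiv 2 (Fin 2 → ℝ)).symm ![-(y 1), y 0]

abbrev E2 := EuclideanSpace ℝ (Fin 2)

noncomputable def kerK (α : ℝ) (z : E2) : E2 := (‖z‖ ^ (2 + α))⁻¹ • perpVec z

lemma perpVec_sub (x y : E2) : perpVec (x - y) = perpVec x - perpVec y := by
  ext i; fin_cases i <;> simp [perpVec]; ring

lemma perpVec_neg (x : E2) : perpVec (-x) = - perpVec x := by
  ext i; fin_cases i <;> simp [perpVec]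

lemma norm_perpVec (x : E2) : ‖perpVec x‖ = ‖x‖ := by
  simp [EuclideanSpace.norm_eq, perpVec, Fin.sum_univ_two, add_comm]

lemma continuous_perpVec : Continuous perpVec := by
  have h : Isometry perpVec := Isometry.of_dist_eq (fun x y => by
    rw [dist_eq_norm, ← perpVec_sub, norm_perpVec, dist_eq_norm])
  exact h.continuous

lemma kerK_neg (α : ℝ) (z : E2) : kerK α (-z) = - kerK α z := by
  simp [kerK, perpVec_neg]

lemma measurable_kerK (α : ℝ) : Measurable (kerK α) := by
  unfold kerK
  have := continuous_perpVec.measurable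
  fun_prop

lemma norm_kerK (α : ℝ) (hα : 0 < α) (z : E2) : ‖kerK α z‖ = ‖z‖ ^ (-(1 + α)) := by
  rw [kerK, norm_smul, norm_perpVec, norm_inv, Real.norm_of_nonneg (by positivity)]
  rcases eq_or_ne z 0 with rfl | hz
  · rw [norm_zero, mul_zero, Real.zero_rpow (by linarith)]
  · have h : 0 < ‖z‖ := norm_pos_iff.2 hz
    rw [← Real.rpow_neg h.le]
    nth_rw 2 [← Real.rpow_one ‖z‖]
    rw [← Real.rpow_add h]; ring_nf

lemma rpow_diff {p m a b : ℝ} (hp : 0 < p) (hm : 0 < m) (ha : m ≤ a) (hb : m ≤ b) :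
    |a ^ (-p) - b ^ (-p)| ≤ p * m ^ (-p - 1) * |a - b| := by
  have := Convex.norm_image_sub_le_of_norm_hasDerivWithin_le (f := fun x : ℝ => x ^ (-p))
    (f' := fun x => -p * x ^ (-p - 1)) (s := Ici m) (x := b) (y := a)
    (C := p * m ^ (-p - 1)) (fun x hx => ?_) (fun x hx => ?_) (convex_Ici m) hb ha
  · simpa using this
  · exact (Real.hasDerivAt_rpow_const (Or.inl (by have := mem_Ici.1 hx; linarith : x ≠ 0))).hasDerivWithinAt
  · have hx' := mem_Ici.1 hx
    rw [norm_mul, norm_neg, Real.norm_of_nonneg hp.le, Real.norm_of_nonneg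
      (Real.rpow_nonneg (hm.le.trans hx') _)]
    exact mul_le_mul_of_nonneg_left (Real.rpow_le_rpow_of_nonpos hm hx' (by linarith)) hp.le

lemma kerK_diff (α : ℝ) (hα : 0 < α) : ∃ C > 0, ∀ z h : E2, 2 * ‖h‖ < ‖z‖ →
    ‖kerK α z - kerK α (z + h)‖ ≤ C * ‖h‖ * ‖z‖ ^ (-(2 + α)) := by
  refine ⟨1 + (2 + α) * (1/2 : ℝ) ^ (-(2 + α) - 1) * (3 / 2), by positivity, fun z h hz => ?_⟩
  have hz0 : 0 < ‖z‖ := by linarith [norm_nonneg h]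
  have h1 : ‖z‖ ≤ ‖z + h‖ + ‖h‖ := by simpa using norm_sub_le (z + h) h
  have h2 : ‖z + h‖ ≤ ‖z‖ + ‖h‖ := norm_add_le _ _
  have h3 : |‖z‖ - ‖z + h‖| ≤ ‖h‖ := abs_le.2 ⟨by linarith, by linarith⟩
  have e : kerK α z - kerK α (z + h) = ‖z‖ ^ (-(2 + α)) • perpVec (-h)
      + (‖z‖ ^ (-(2 + α)) - ‖z + h‖ ^ (-(2 + α))) • perpVec (z + h) := by
    have : -h = z - (z + h) := by abel
    rw [this, perpVec_sub, kerK, kerK, Real.rpow_neg (norm_nonneg _), Real.rpow_neg (norm_nonneg _)]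
    module
  have hd := rpow_diff (p := 2 + α) (m := 1 / 2 * ‖z‖) (a := ‖z‖) (b := ‖z + h‖) (by linarith)
    (by positivity) (by linarith) (by linarith)
  have hm : (1 / 2 * ‖z‖) ^ (-(2 + α) - 1) * ‖z‖ = (1/2 : ℝ) ^ (-(2 + α) - 1) * ‖z‖ ^ (-(2 + α)) := by
    rw [Real.mul_rpow (by norm_num) hz0.le, Real.rpow_sub_one hz0.ne' (-(2+α))]
    field_simp
  rw [e]
  refine (norm_add_le _ _).trans ?_
  rw [norm_smul, norm_smul, norm_perpVec, norm_perpVec, norm_neg, Real.norm_of_nonneg (by positivity),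
    Real.norm_eq_abs]
  have : |‖z‖ ^ (-(2 + α)) - ‖z + h‖ ^ (-(2 + α))| * ‖z + h‖ ≤
      ((2 + α) * (1 / 2 * ‖z‖) ^ (-(2 + α) - 1) * ‖h‖) * (3 / 2 * ‖z‖) := by
    gcongr
    · exact hd.trans (by gcongr)
    · linarith
  calc _ ≤ ‖z‖ ^ (-(2 + α)) * ‖h‖ + ((2 + α) * (1 / 2 * ‖z‖) ^ (-(2 + α) - 1) * ‖h‖) * (3 / 2 * ‖z‖) := by
        linarith
    _ = ‖z‖ ^ (-(2 + α)) * ‖h‖ + (2 + α) * ‖h‖ * (3 / 2) * ((1 / 2 * ‖z‖) ^ (-(2 + α) - 1) * ‖z‖) := by ring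
    _ = _ := by rw [hm]; ring

lemma radial (f g : ℝ → ℝ) (s : Set ℝ) (hs : MeasurableSet s) (hs0 : s ⊆ Ioi 0)
    (hfg : ∀ r > 0, r * f r = s.indicator g r) (hg : IntegrableOn g s) :
    Integrable (fun z : E2 => f ‖z‖) ∧ ∫ z : E2, f ‖z‖ = 2 * Real.pi * ∫ r in s, g r := by
  have hE : ∀ r ∈ Ioi (0:ℝ), r ^ (Module.finrank ℝ E2 - 1) • f r = s.indicator g r := by
    intro r hr
    simpa using hfg r hr
  constructor
  · rw [integrable_fun_norm_addHaar, integrableOn_congr_fun hE measurableSet_Ioi]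
    exact ((integrable_indicator_iff hs).2 hg).integrableOn
  · rw [integral_fun_norm_addHaar, setIntegral_congr_fun measurableSet_Ioi hE,
      setIntegral_indicator hs, inter_eq_right.2 hs0]
    simp [Measure.real, mul_assoc]
    exact Or.inl Real.pi_pos.le

lemma near (α : ℝ) (hα1 : 0 < α) (hα2 : α < 1) (ρ : ℝ) (hρ : 0 < ρ) :
    IntegrableOn (fun z => ‖kerK α z‖) (closedBall (0 : E2) ρ) ∧
    ∫ z in closedBall (0 : E2) ρ, ‖kerK α z‖ = 2 * Real.pi * (ρ ^ (1 - α) / (1 - α)) := by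
  have hi : IntervalIntegrable (fun r : ℝ => r ^ (-α)) volume 0 ρ :=
    intervalIntegral.intervalIntegrable_rpow' (by linarith)
  have h := radial (fun r => (Iic ρ).indicator (fun r => r ^ (-(1 + α))) r) (fun r => r ^ (-α))
    (Ioc 0 ρ) measurableSet_Ioc (fun r hr => hr.1) ?_ hi.1
  · have e : (fun z : E2 => (Iic ρ).indicator (fun r => r ^ (-(1 + α))) ‖z‖) =
        (closedBall (0 : E2) ρ).indicator (fun z => ‖kerK α z‖) := by
      ext z
      simp [indicator, norm_kerK α hα1]
    rw [e, integrable_indicator_iff measurableSet_closedBall,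
      integral_indicator measurableSet_closedBall, ← intervalIntegral.integral_of_le hρ.le,
      integral_rpow (Or.inl (by linarith)), Real.zero_rpow (by linarith)] at h
    refine ⟨h.1, h.2.trans ?_⟩
    ring_nf
  · intro r hr
    have hr' : 0 < r := hr
    by_cases h : r ≤ ρ
    · simp only [indicator, mem_Iic, mem_Ioc, h, hr', and_self, if_true]
      rw [show -α = -(1 + α) + 1 by ring, Real.rpow_add_one hr'.ne']; ring
    · simp [indicator, h]

lemma far (α : ℝ) (ω : ℝ → ℝ) (ρ : ℝ) (hρ : 0 < ρ)
    (hi : IntegrableOn (fun η => ω η / η ^ (1 + α)) (Ioi ρ)) :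
    Integrable (fun z : E2 => (Ioi ρ).indicator (fun r => ω r * r ^ (-(2 + α))) ‖z‖) ∧
    ∫ z : E2, (Ioi ρ).indicator (fun r => ω r * r ^ (-(2 + α))) ‖z‖ =
      2 * Real.pi * ∫ η in Ioi ρ, ω η / η ^ (1 + α) := by
  refine radial _ _ (Ioi ρ) measurableSet_Ioi (fun r hr => hρ.trans hr) ?_ hi
  intro r hr
  by_cases h : ρ < r
  · simp only [indicator, mem_Ioi, h, if_true]
    rw [show -(2 + α) = -(1 + α) - 1 by ring, Real.rpow_sub_one hr.ne', Real.rpow_neg hr.le]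
    field_simp
  · simp [indicator, h]

lemma shell (R ξ m : ℝ) (hξ : 0 < ξ) (hR : ξ < R) (hm : 0 ≤ m) :
    Integrable (fun z : E2 => (Ioc (R - ξ) (R + ξ)).indicator (fun _ => m) ‖z‖) ∧
    ∫ z : E2, (Ioc (R - ξ) (R + ξ)).indicator (fun _ => m) ‖z‖ ≤
      2 * Real.pi * ((R + ξ) * m * (2 * ξ)) := by
  have hi : IntegrableOn (fun r : ℝ => r * m) (Ioc (R - ξ) (R + ξ)) :=
    (Continuous.integrableOn_Icc (by fun_prop)).mono_set Ioc_subset_Icc_self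
  have h := radial (fun r => (Ioc (R - ξ) (R + ξ)).indicator (fun _ => m) r) (fun r => r * m)
    _ measurableSet_Ioc (fun r hr => by have := hr.1; simp only [mem_Ioi]; linarith) ?_ hi
  · refine ⟨h.1, h.2.le.trans ?_⟩
    refine mul_le_mul_of_nonneg_left ?_ (by positivity)
    have := norm_setIntegral_le_of_norm_le_const (μ := volume) (s := Ioc (R - ξ) (R + ξ))
      (f := fun r : ℝ => r * m) (C := (R + ξ) * m) (by simp) (fun r hr => by
        have h1 := hr.1
        rw [Real.norm_of_nonneg (mul_nonneg (by linarith) hm)]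
        exact mul_le_mul_of_nonneg_right hr.2 hm)
    refine (le_abs_self _).trans (this.trans (le_of_eq ?_))
    simp [Measure.real]
    left; rw [ENNReal.toReal_ofReal (by linarith)]; ring
  · intro r hr
    by_cases h : r ∈ Ioc (R - ξ) (R + ξ) <;> simp [h]

lemma kerK_integrableOn (α : ℝ) (hα1 : 0 < α) (hα2 : α < 1) (R : ℝ) (hR : 0 < R) :
    IntegrableOn (kerK α) (closedBall (0 : E2) R) :=
  (integrable_norm_iff (measurable_kerK α).aestronglyMeasurable).1 (near α hα1 hα2 R hR).1

lemma integral_kerK (α R : ℝ) : ∫ z in closedBall (0 : E2) R, kerK α z = 0 := by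
  rw [← integral_indicator measurableSet_closedBall]
  have h := integral_neg_eq_self ((closedBall (0 : E2) R).indicator (kerK α)) volume
  have e : ∀ z : E2, (closedBall (0 : E2) R).indicator (kerK α) (-z) =
      - (closedBall (0 : E2) R).indicator (kerK α) z := by
    intro z
    by_cases hz : ‖z‖ ≤ R <;> simp [indicator, hz, kerK_neg]
  simp only [e, integral_neg] at h
  have h2 : (2 : ℝ) • ∫ a : E2, (closedBall (0 : E2) R).indicator (kerK α) a = 0 := by
    rw [two_smul]; nth_rw 1 [← h]; exact neg_add_cancel _
  exact (smul_eq_zero.1 h2).resolve_left two_ne_zero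

lemma smul_kerK_integrableOn (α : ℝ) (hα1 : 0 < α) (hα2 : α < 1) (R : ℝ) (hR : 0 < R)
    (g : E2 → ℝ) (hg : Continuous g) (M : ℝ) (hM : ∀ z, |g z| ≤ M) :
    IntegrableOn (fun z => g z • kerK α z) (closedBall (0 : E2) R) :=
  (kerK_integrableOn α hα1 hα2 R hR).bdd_smul M hg.aestronglyMeasurable
    (Eventually.of_forall hM)

lemma trunc_eq (α : ℝ) (hα1 : 0 < α) (hα2 : α < 1) (R : ℝ) (hR : 0 < R) (c t : ℝ)
    (g : E2 → ℝ) (hg : Continuous g) (M : ℝ) (hM : ∀ z, |g z| ≤ M) :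
    ∫ y in closedBall (0 : E2) R, (c * g y / ‖y‖ ^ (2 + α)) • perpVec y =
      c • ∫ y, (closedBall (0 : E2) R).indicator (fun y => (g y - t) • kerK α y) y := by
  rw [integral_indicator measurableSet_closedBall]
  have h1 := smul_kerK_integrableOn α hα1 hα2 R hR g hg M hM
  have h2 : IntegrableOn (fun z => t • kerK α z) (closedBall (0 : E2) R) :=
    (kerK_integrableOn α hα1 hα2 R hR).smul t
  have : ∫ y in closedBall (0 : E2) R, (g y - t) • kerK α y =
      ∫ y in closedBall (0 : E2) R, g y • kerK α y := by
    simp only [sub_smul]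
    rw [integral_sub h1 h2, integral_smul, integral_kerK]; simp
  rw [this, ← integral_smul]
  congr 1
  ext1 y
  rw [kerK, smul_smul, smul_smul]
  congr 1

lemma key (α : ℝ) (hα1 : 0 < α) (hα2 : α < 1) (C : ℝ) (hC : 0 < C)
    (hK : ∀ z h : E2, 2 * ‖h‖ < ‖z‖ →
      ‖kerK α z - kerK α (z + h)‖ ≤ C * ‖h‖ * ‖z‖ ^ (-(2 + α)))
    (ω : ℝ → ℝ) (hmono : MonotoneOn ω (Ici 0)) (h0 : ω 0 = 0)
    (h : E2) (hh : h ≠ 0)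
    (hi : IntegrableOn (fun η => ω η / η ^ (1 + α)) (Ioi (2 * ‖h‖)))
    (g : E2 → ℝ) (hg : Continuous g) (M : ℝ) (hM : ∀ z, |g z| ≤ M)
    (hgω : ∀ z, |g z| ≤ ω ‖z‖) (R : ℝ) (hR : 3 * ‖h‖ < R) :
    ‖(∫ z, (closedBall (0 : E2) R).indicator (fun z => g z • kerK α z) z) -
      ∫ z, (closedBall (0 : E2) R).indicator (fun w => g (w - h) • kerK α w) z‖ ≤
    (ω (2 * ‖h‖) * (2 * Real.pi * ((2 * ‖h‖) ^ (1 - α) / (1 - α))) +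
      ω (2 * ‖h‖) * (2 * Real.pi * ((3 * ‖h‖) ^ (1 - α) / (1 - α)))) +
      C * ‖h‖ * (2 * Real.pi * ∫ η in Ioi (2 * ‖h‖), ω η / η ^ (1 + α)) +
      2 * Real.pi * ((R + ‖h‖) * (M * (R - ‖h‖) ^ (-(1 + α))) * (2 * ‖h‖)) := by
  set ξ := ‖h‖ with hξ
  have hξ0 : 0 < ξ := norm_pos_iff.2 hh
  have hM0 : 0 ≤ M := (abs_nonneg _).trans (hM 0)
  have hω : ∀ r, 0 ≤ r → 0 ≤ ω r := fun r hr => by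
    rw [← h0]; exact hmono self_mem_Ici hr hr
  set B := closedBall (0 : E2) R
  have hR0 : 0 < R := by linarith
  have i1 : Integrable (B.indicator (fun z => g z • kerK α z)) :=
    (integrable_indicator_iff measurableSet_closedBall).2
      (smul_kerK_integrableOn α hα1 hα2 R hR0 g hg M hM)
  have i2' : Integrable (B.indicator (fun w => g (w - h) • kerK α w)) :=
    (integrable_indicator_iff measurableSet_closedBall).2
      (smul_kerK_integrableOn α hα1 hα2 R hR0 (fun w => g (w - h)) (by fun_prop) M (fun z => hM _))
  have i2 := i2'.comp_add_right h
  rw [← integral_add_right_eq_self (B.indicator (fun w => g (w - h) • kerK α w)) h,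
    ← integral_sub i1 i2]
  have n1 := near α hα1 hα2 (2 * ξ) (by positivity)
  have n2 := near α hα1 hα2 (3 * ξ) (by positivity)
  have n3 := far α ω (2 * ξ) (by positivity) hi
  have n4 := shell R ξ (M * (R - ξ) ^ (-(1 + α))) hξ0 (by linarith)
    (mul_nonneg hM0 (Real.rpow_nonneg (by linarith) _))
  rw [← integrable_indicator_iff measurableSet_closedBall,
    ← integral_indicator measurableSet_closedBall] at n1 n2
  obtain ⟨a1, b1⟩ := n1
  obtain ⟨a2', b2⟩ := n2
  obtain ⟨a3, b3⟩ := n3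
  obtain ⟨a4, b4⟩ := n4
  have a2 := a2'.comp_add_right h
  rw [← integral_add_right_eq_self _ h] at b2
  have a12 : Integrable (fun z => ω (2 * ξ) * (closedBall 0 (2 * ξ)).indicator (fun z => ‖kerK α z‖) z +
      ω (2 * ξ) * (closedBall 0 (3 * ξ)).indicator (fun z => ‖kerK α z‖) (z + h)) :=
    (a1.const_mul _).add (a2.const_mul _)
  have a123 : Integrable (fun z =>
      ω (2 * ξ) * (closedBall 0 (2 * ξ)).indicator (fun z => ‖kerK α z‖) z +
      ω (2 * ξ) * (closedBall 0 (3 * ξ)).indicator (fun z => ‖kerK α z‖) (z + h) +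
      C * ξ * (Ioi (2 * ξ)).indicator (fun r => ω r * r ^ (-(2 + α))) ‖z‖) :=
    a12.add (a3.const_mul _)
  rw [← b1, ← b2, ← b3, ← integral_const_mul, ← integral_const_mul, ← integral_const_mul,
    ← integral_add (a1.const_mul _) (a2.const_mul _), ← integral_add a12 (a3.const_mul _)]
  refine le_trans ?_ (add_le_add_right b4 _)
  rw [← integral_add a123 a4]
  refine norm_integral_le_of_norm_le
    (a123.add a4)
    (Eventually.of_forall fun z => ?_)
  have h1 : ‖z‖ ≤ ‖z + h‖ + ξ := by simpa using norm_sub_le (z + h) h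
  have h2 : ‖z + h‖ ≤ ‖z‖ + ξ := norm_add_le _ _
  have hw2 := hω (2 * ξ) (by positivity)
  have hRξ : 0 < R - ξ := by linarith
  have hm0 : 0 ≤ M * (R - ξ) ^ (-(1 + α)) := mul_nonneg hM0 (Real.rpow_nonneg hRξ.le _)
  simp only [indicator, B, mem_closedBall, dist_zero_right, mem_Ioi, mem_Ioc, add_sub_cancel_right]
  have p3 : 0 ≤ C * ξ * (if 2 * ξ < ‖z‖ then ω ‖z‖ * ‖z‖ ^ (-(2 + α)) else 0) := by
    split_ifs
    · have := hω _ (norm_nonneg z); positivity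
    · simp
  have p4 : 0 ≤ (if R - ξ < ‖z‖ ∧ ‖z‖ ≤ R + ξ then M * (R - ξ) ^ (-(1 + α)) else 0) := by
    split_ifs
    · exact hm0
    · simp
  have p1 : 0 ≤ ω (2 * ξ) * (if ‖z‖ ≤ 2 * ξ then ‖kerK α z‖ else 0) := by
    split_ifs <;> positivity
  have p2 : 0 ≤ ω (2 * ξ) * (if ‖z + h‖ ≤ 3 * ξ then ‖kerK α (z + h)‖ else 0) := by
    split_ifs <;> positivity
  have kb : ∀ w : E2, R - ξ ≤ ‖w‖ → ‖g z • kerK α w‖ ≤ M * (R - ξ) ^ (-(1 + α)) := by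
    intro w hw
    rw [norm_smul, norm_kerK α hα1]
    exact mul_le_mul (hM z) (Real.rpow_le_rpow_of_nonpos hRξ hw (by linarith)) (by positivity) hM0
  by_cases hz : ‖z‖ ≤ 2 * ξ
  · rw [if_pos (by linarith : ‖z‖ ≤ R), if_pos (by linarith : ‖z + h‖ ≤ R)]
    rw [if_pos hz, if_pos (by linarith : ‖z + h‖ ≤ 3 * ξ)]
    have hgz : |g z| ≤ ω (2 * ξ) := (hgω z).trans (hmono (norm_nonneg z) (by
      simp only [mem_Ici]; positivity) hz)
    have q := norm_sub_le (g z • kerK α z) (g z • kerK α (z + h))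
    rw [norm_smul, norm_smul, Real.norm_eq_abs] at q
    have q1 := mul_le_mul_of_nonneg_right hgz (norm_nonneg (kerK α z))
    have q2 := mul_le_mul_of_nonneg_right hgz (norm_nonneg (kerK α (z + h)))
    linarith
  · have hz' := not_le.1 hz
    by_cases c1 : ‖z‖ ≤ R <;> by_cases c2 : ‖z + h‖ ≤ R
    · rw [if_pos c1, if_pos c2]
      rw [if_pos hz'] at p3 ⊢
      have q : ‖g z • kerK α z - g z • kerK α (z + h)‖ ≤
          C * ξ * (ω ‖z‖ * ‖z‖ ^ (-(2 + α))) := by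
        rw [← smul_sub, norm_smul, Real.norm_eq_abs]
        calc _ ≤ ω ‖z‖ * (C * ξ * ‖z‖ ^ (-(2 + α))) :=
              mul_le_mul (hgω z) (hK z h hz') (norm_nonneg _) (hω _ (norm_nonneg z))
          _ = _ := by ring
      linarith
    · rw [if_pos c1, if_neg c2, sub_zero]
      have c2' := not_le.1 c2
      rw [if_pos (⟨by linarith, by linarith⟩ : R - ξ < ‖z‖ ∧ ‖z‖ ≤ R + ξ)]
      have := kb z (by linarith)
      linarith
    · rw [if_neg c1, if_pos c2, zero_sub, norm_neg]
      have c1' := not_le.1 c1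
      rw [if_pos (⟨by linarith, by linarith⟩ : R - ξ < ‖z‖ ∧ ‖z‖ ≤ R + ξ)]
      have := kb (z + h) (by linarith)
      linarith
    · rw [if_neg c1, if_neg c2, sub_zero, norm_zero]
      linarith

lemma omega_facts (α : ℝ) (hα1 : 0 < α) (hα2 : α < 1) (ω : ℝ → ℝ)
    (hconc : ConcaveOn ℝ (Ici 0) ω) (hmono : MonotoneOn ω (Ici 0))
    (hcont : ContinuousOn ω (Ici 0)) (h0 : ω 0 = 0)
    (hint : IntegrableOn (fun η => ω η / η ^ (1 + α)) (Ioi 1)) (ξ : ℝ) (hξ : 0 < ξ) :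
    ω (2 * ξ) ≤ 2 * ω ξ ∧
    ω ξ * ξ ^ (1 - α) ≤ 2 * ∫ η in Ioc 0 ξ, ω η / η ^ α ∧
    IntegrableOn (fun η => ω η / η ^ (1 + α)) (Ioi ξ) := by
  have hω : ∀ r, 0 ≤ r → 0 ≤ ω r := fun r hr => by
    rw [← h0]; exact hmono self_mem_Ici hr hr
  have hstar : ∀ r t, 0 ≤ r → 0 ≤ t → t ≤ 1 → t * ω r ≤ ω (t * r) := by
    intro r t hr ht ht1
    have := hconc.2 (show r ∈ Ici 0 from hr) (self_mem_Ici (a := (0 : ℝ))) ht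
      (show 0 ≤ 1 - t by linarith) (by ring)
    simpa [h0] using this
  refine ⟨?_, ?_, ?_⟩
  · have := hstar (2 * ξ) (1 / 2) (by positivity) (by norm_num) (by norm_num)
    rw [show (1 / 2 : ℝ) * (2 * ξ) = ξ by ring] at this
    linarith
  · have hcomp : IntervalIntegrable (fun η : ℝ => (ω ξ / ξ) * η ^ (1 - α)) volume 0 ξ :=
      (intervalIntegral.intervalIntegrable_rpow' (by linarith)).const_mul _
    have hi : IntegrableOn (fun η => ω η / η ^ α) (Ioc 0 ξ) := by
      have hb : IntervalIntegrable (fun η : ℝ => ω ξ * η ^ (-α)) volume 0 ξ :=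
        (intervalIntegral.intervalIntegrable_rpow' (by linarith)).const_mul _
      refine Integrable.mono' hb.1 ?_ ?_
      · refine ContinuousOn.aestronglyMeasurable ?_ measurableSet_Ioc
        refine (hcont.mono (fun r hr => hr.1.le)).div ?_ ?_
        · exact ContinuousOn.rpow_const continuousOn_id (fun r hr => Or.inl hr.1.ne')
        · intro r hr
          exact (Real.rpow_pos_of_pos hr.1 _).ne'
      · refine (ae_restrict_iff' measurableSet_Ioc).2 (Eventually.of_forall fun r hr => ?_)
        rw [Real.norm_of_nonneg (div_nonneg (hω _ hr.1.le) (Real.rpow_nonneg hr.1.le _)),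
          Real.rpow_neg hr.1.le, div_eq_mul_inv]
        exact mul_le_mul_of_nonneg_right (hmono hr.1.le hξ.le hr.2)
          (inv_nonneg.2 (Real.rpow_nonneg hr.1.le _))
    have hle : ∫ η in Ioc 0 ξ, (ω ξ / ξ) * η ^ (1 - α) ≤ ∫ η in Ioc 0 ξ, ω η / η ^ α := by
      refine setIntegral_mono_on hcomp.1 hi measurableSet_Ioc (fun r hr => ?_)
      have := hstar ξ (r / ξ) hξ.le (div_nonneg hr.1.le hξ.le) ((div_le_one hξ).2 hr.2)
      rw [div_mul_cancel₀ _ hξ.ne'] at this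
      have hp := Real.rpow_pos_of_pos hr.1 α
      rw [le_div_iff₀ hp, mul_assoc, ← Real.rpow_add hr.1, sub_add_cancel, Real.rpow_one]
      calc _ = r / ξ * ω ξ := by ring
        _ ≤ _ := this
    rw [← intervalIntegral.integral_of_le hξ.le, intervalIntegral.integral_const_mul,
      integral_rpow (Or.inl (by linarith)), Real.zero_rpow (by linarith), sub_zero,
      Real.rpow_add_one hξ.ne'] at hle
    have e : ω ξ / ξ * (ξ ^ (1 - α) * ξ / (1 - α + 1)) = ω ξ * ξ ^ (1 - α) / (2 - α) := by
      have : (1 - α + 1) ≠ 0 := by linarith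
      have : (2 - α) ≠ 0 := by linarith
      field_simp
      ring
    rw [e, div_le_iff₀ (by linarith)] at hle
    have hnn : 0 ≤ ∫ η in Ioc 0 ξ, ω η / η ^ α :=
      setIntegral_nonneg measurableSet_Ioc (fun r hr =>
        div_nonneg (hω _ hr.1.le) (Real.rpow_nonneg hr.1.le _))
    nlinarith
  · have hcc : IntegrableOn (fun η => ω η / η ^ (1 + α)) (Icc ξ 1) := by
      refine ContinuousOn.integrableOn_Icc ?_
      refine (hcont.mono (fun r hr => hξ.le.trans hr.1)).div ?_ ?_
      · exact ContinuousOn.rpow_const continuousOn_id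
          (fun r hr => Or.inl (hξ.trans_le hr.1).ne')
      · intro r hr
        exact (Real.rpow_pos_of_pos (hξ.trans_le hr.1) _).ne'
    refine (hcc.union hint).mono_set (fun r hr => ?_)
    by_cases h : r ≤ 1
    · exact Or.inl ⟨(mem_Ioi.1 hr).le, h⟩
    · exact Or.inr (not_le.1 h)

lemma shell_lim (α : ℝ) (hα1 : 0 < α) (M ξ : ℝ) :
    Tendsto (fun R : ℝ => 2 * Real.pi * ((R + ξ) * (M * (R - ξ) ^ (-(1 + α))) * (2 * ξ)))
      atTop (nhds 0) := by
  have t1 : Tendsto (fun R : ℝ => R - ξ) atTop atTop := tendsto_atTop_add_const_right _ _ tendsto_id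
  have t2 := (tendsto_rpow_neg_atTop hα1).comp t1
  have t3 := (tendsto_rpow_neg_atTop (by linarith : 0 < 1 + α)).comp t1
  have t4 : Tendsto (fun R : ℝ => (2 * Real.pi * M * (2 * ξ)) * ((R - ξ) ^ (-α) +
      2 * ξ * (R - ξ) ^ (-(1 + α)))) atTop (nhds 0) := by
    simpa using (t2.add (t3.const_mul (2 * ξ))).const_mul (2 * Real.pi * M * (2 * ξ))
  refine t4.congr' ?_
  filter_upwards [eventually_gt_atTop ξ] with R hR
  have : 0 < R - ξ := by linarith
  rw [show -α = -(1 + α) + 1 by ring, Real.rpow_add_one this.ne']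
  ring

/-- If θ has modulus of continuity ω, then u = |D|^{α−1} R^⊥ θ (given by the singular
integral with kernel c y^⊥/|y|^{2+α}) has modulus of continuity
Ω(ξ) = A_α (∫₀^ξ ω(η)/η^α dη + ξ ∫_ξ^∞ ω(η)/η^{1+α} dη). -/
theorem stmt_4 (α : ℝ) (hα1 : 0 < α) (hα2 : α < 1) (c : ℝ) :
    ∃ A > 0, ∀ ω : ℝ → ℝ, ConcaveOn ℝ (Ici 0) ω → MonotoneOn ω (Ici 0) →
      ContinuousOn ω (Ici 0) → ω 0 = 0 →
      IntegrableOn (fun η => ω η / η ^ (1 + α)) (Ioi 1) →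
      ∀ (θ : EuclideanSpace ℝ (Fin 2) → ℝ) (M : ℝ), ContDiff ℝ (⊤ : ℕ∞) θ →
        (∀ x, |θ x| ≤ M) →
        (∀ x y, |θ x - θ y| ≤ ω ‖x - y‖) →
      ∀ u : EuclideanSpace ℝ (Fin 2) → EuclideanSpace ℝ (Fin 2),
        (∀ x, Tendsto (fun R : ℝ =>
            ∫ y in closedBall (0 : EuclideanSpace ℝ (Fin 2)) R,
              (c * θ (x - y) / ‖y‖ ^ (2 + α)) • perpVec y) atTop (nhds (u x))) →
      ∀ x y : EuclideanSpace ℝ (Fin 2), x ≠ y →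
        ‖u x - u y‖ ≤ A * ((∫ η in Ioc 0 ‖x - y‖, ω η / η ^ α) +
          ‖x - y‖ * ∫ η in Ioi ‖x - y‖, ω η / η ^ (1 + α)) := by
  obtain ⟨C, hC, hK⟩ := kerK_diff α hα1
  have hα3 : 0 < 1 - α := by linarith
  have hπ := Real.pi_pos
  refine ⟨|c| * (20 * (2 * Real.pi / (1 - α)) + C * (2 * Real.pi)) + 1, by positivity, ?_⟩
  intro ω hconc hmono hcont h0 hint θ M hθ hM hθω u hu x y hxy
  set ξ := ‖x - y‖ with hξdef
  have hξ : 0 < ξ := norm_pos_iff.2 (sub_ne_zero.2 hxy)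
  have hω : ∀ r, 0 ≤ r → 0 ≤ ω r := fun r hr => by
    rw [← h0]; exact hmono self_mem_Ici hr hr
  have hθc : Continuous θ := hθ.continuous
  obtain ⟨f1, f2, f3⟩ := omega_facts α hα1 hα2 ω hconc hmono hcont h0 hint ξ hξ
  obtain ⟨-, -, f4⟩ := omega_facts α hα1 hα2 ω hconc hmono hcont h0 hint (2 * ξ) (by positivity)
  have hh : ‖y - x‖ = ξ := norm_sub_rev _ _
  set P := ∫ η in Ioc 0 ξ, ω η / η ^ α
  set Q := ∫ η in Ioi ξ, ω η / η ^ (1 + α)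
  have hQ2 : ∫ η in Ioi (2 * ξ), ω η / η ^ (1 + α) ≤ Q := by
    refine setIntegral_mono_set f3 ?_ (Ioi_subset_Ioi (by linarith)).eventuallyLE
    refine (ae_restrict_iff' measurableSet_Ioi).2 (Eventually.of_forall fun r hr => ?_)
    have hr0 : 0 ≤ r := (hξ.trans hr).le
    exact div_nonneg (hω _ hr0) (Real.rpow_nonneg hr0 _)
  have hQ : 0 ≤ Q := by
    refine setIntegral_nonneg measurableSet_Ioi fun r hr => ?_
    have hr0 : 0 ≤ r := (hξ.trans hr).le
    exact div_nonneg (hω _ hr0) (Real.rpow_nonneg hr0 _)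
  have hP : 0 ≤ P := setIntegral_nonneg measurableSet_Ioc (fun r hr =>
        div_nonneg (hω _ hr.1.le) (Real.rpow_nonneg hr.1.le _))
  set T := (ω (2 * ξ) * (2 * Real.pi * ((2 * ξ) ^ (1 - α) / (1 - α))) +
      ω (2 * ξ) * (2 * Real.pi * ((3 * ξ) ^ (1 - α) / (1 - α)))) +
      C * ξ * (2 * Real.pi * ∫ η in Ioi (2 * ξ), ω η / η ^ (1 + α)) with hT
  have hlim : ‖u x - u y‖ ≤ |c| * (T + 0) := by
    refine le_of_tendsto_of_tendsto ((hu x).sub (hu y)).norm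
      ((tendsto_const_nhds.add (shell_lim α hα1 (2 * M) ξ)).const_mul |c|) ?_
    filter_upwards [eventually_gt_atTop (3 * ξ)] with R hR
    have hR0 : 0 < R := by linarith
    rw [trunc_eq α hα1 hα2 R hR0 c (θ x) (fun z => θ (x - z)) (by fun_prop) M (fun z => hM _),
      trunc_eq α hα1 hα2 R hR0 c (θ x) (fun z => θ (y - z)) (by fun_prop) M (fun z => hM _),
      ← smul_sub, norm_smul, Real.norm_eq_abs]
    refine mul_le_mul_of_nonneg_left ?_ (abs_nonneg c)
    have k := key α hα1 hα2 C hC hK ω hmono h0 (y - x) (sub_ne_zero.2 hxy.symm)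
      (by rw [hh]; exact f4) (fun z => θ (x - z) - θ x) (by fun_prop) (2 * M)
      (fun z => (abs_sub _ _).trans (by linarith [hM (x - z), hM x]))
      (fun z => (hθω _ _).trans (by simp)) R (by rw [hh]; exact hR)
    rw [hh] at k
    have e : ∀ w : E2, x - (w - (y - x)) = y - w := fun w => by abel
    simp only [e] at k
    exact k
  have g2 : (2 * ξ) ^ (1 - α) ≤ 2 * ξ ^ (1 - α) := by
    rw [Real.mul_rpow (by norm_num) hξ.le]
    refine mul_le_mul_of_nonneg_right ?_ (by positivity)
    exact Real.rpow_le_self_of_one_le (by norm_num) (by linarith)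
  have g3 : (3 * ξ) ^ (1 - α) ≤ 3 * ξ ^ (1 - α) := by
    rw [Real.mul_rpow (by norm_num) hξ.le]
    refine mul_le_mul_of_nonneg_right ?_ (by positivity)
    exact Real.rpow_le_self_of_one_le (by norm_num) (by linarith)
  have hT2 : T ≤ 20 * (2 * Real.pi / (1 - α)) * P + C * (2 * Real.pi) * (ξ * Q) := by
    have w2 := hω (2 * ξ) (by positivity)
    have e1 : T = (2 * Real.pi / (1 - α)) * (ω (2 * ξ) * ((2 * ξ) ^ (1 - α) + (3 * ξ) ^ (1 - α))) +
      C * (2 * Real.pi) * (ξ * ∫ η in Ioi (2 * ξ), ω η / η ^ (1 + α)) := by rw [hT]; ring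
    have e2 : ω (2 * ξ) * ((2 * ξ) ^ (1 - α) + (3 * ξ) ^ (1 - α)) ≤ 20 * P := by
      calc _ ≤ (2 * ω ξ) * (5 * ξ ^ (1 - α)) := by
            refine mul_le_mul f1 (by linarith) (by positivity) (by linarith)
        _ = 10 * (ω ξ * ξ ^ (1 - α)) := by ring
        _ ≤ 20 * P := by linarith
    rw [e1]
    have e3 := mul_le_mul_of_nonneg_left e2 (by positivity : 0 ≤ 2 * Real.pi / (1 - α))
    have e4 : C * (2 * Real.pi) * (ξ * ∫ η in Ioi (2 * ξ), ω η / η ^ (1 + α)) ≤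
      C * (2 * Real.pi) * (ξ * Q) := by gcongr
    linarith
  have hξQ : 0 ≤ ξ * Q := by positivity
  set D := 20 * (2 * Real.pi / (1 - α)) with hD
  have hD0 : 0 ≤ D := by positivity
  have hF : 0 ≤ C * (2 * Real.pi) := by positivity
  set F := C * (2 * Real.pi)
  have h5 : T ≤ (D + F) * (P + ξ * Q) := by nlinarith [mul_nonneg hD0 hξQ, mul_nonneg hF hP]
  calc ‖u x - u y‖ ≤ |c| * (T + 0) := hlim
    _ ≤ |c| * ((D + F) * (P + ξ * Q)) := by rw [add_zero]; gcongr
    _ ≤ (|c| * (D + F) + 1) * (P + ξ * Q) := by linarith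
end

section
/- Let 0 < α < 2 and let ω be a modulus of continuity. Suppose θ : ℝⁿ → ℝ is smooth and bounded with modulus of continuity ω, and θ(x) − θ(y) = ω(ξ) for some x ≠ y with |x − y| = ξ. Then (−|D|^α θ)(x) − (−|D|^α θ)(y) ≤ B_α [ ∫₀^{ξ/2} (ω(ξ+2η) + ω(ξ−2η) − 2ω(ξ))/η^{1+α} dη + ∫_{ξ/2}^∞ (ω(2η+ξ) − ω(2η−ξ) − 2ω(ξ))/η^{1+α} dη ] for some constant B_α > 0 depending only on α and n. -/
open MeasureTheory Set Filter

lemma marg_int (m : ℕ) (α : ℝ) (hα : 0 < α) :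
    Integrable (fun v : Fin m → ℝ => (1 + ∑ i, v i ^ 2) ^ (-(((m + 1 : ℕ) : ℝ) + α) / 2)) := by
  have h := integrable_rpow_neg_one_add_norm_sq (E := EuclideanSpace ℝ (Fin m)) (μ := volume)
    (r := ((m + 1 : ℕ) : ℝ) + α) (by simp; linarith)
  have h2 := ((PiLp.volume_preserving_toLp (Fin m)).integrable_comp_emb
    (MeasurableEquiv.toLp 2 (Fin m → ℝ)).measurableEmbedding).2 h
  refine h2.congr (ae_of_all _ fun v => ?_)
  simp [EuclideanSpace.norm_sq_eq]

lemma marg_pos (m : ℕ) (α : ℝ) (hα : 0 < α) :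
    0 < ∫ v : Fin m → ℝ, (1 + ∑ i, v i ^ 2) ^ (-(((m + 1 : ℕ) : ℝ) + α) / 2) := by
  have hp : ∀ v : Fin m → ℝ, 0 < (1 + ∑ i, v i ^ 2) ^ (-(((m + 1 : ℕ) : ℝ) + α) / 2) := fun v => by
    have : 0 ≤ ∑ i, v i ^ 2 := Finset.sum_nonneg fun i _ => sq_nonneg _
    positivity
  rw [integral_pos_iff_support_of_nonneg (fun v => (hp v).le) (marg_int m α hα)]
  have : Function.support (fun v : Fin m → ℝ => (1 + ∑ i, v i ^ 2) ^ (-(((m + 1 : ℕ) : ℝ) + α) / 2)) = univ := by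
    ext v; simpa using (hp v).ne'
  rw [this]; simp [NeZero.pos]

lemma marg_scale (m : ℕ) (α : ℝ) (s : ℝ) (hs : 0 < s) :
    ∫ v : Fin m → ℝ, (s + ∑ i, v i ^ 2) ^ (-(((m + 1 : ℕ) : ℝ) + α) / 2) =
     s ^ (-(1 + α) / 2) * ∫ v : Fin m → ℝ, (1 + ∑ i, v i ^ 2) ^ (-(((m + 1 : ℕ) : ℝ) + α) / 2) := by
  have h := Measure.integral_comp_smul (volume : Measure (Fin m → ℝ))
    (fun v => (s + ∑ i, v i ^ 2) ^ (-(((m + 1 : ℕ) : ℝ) + α) / 2)) (Real.sqrt s)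
  have h1 : ∀ v : Fin m → ℝ, (s + ∑ i, (Real.sqrt s • v) i ^ 2) ^ (-(((m + 1 : ℕ) : ℝ) + α) / 2)
     = s ^ (-(((m + 1 : ℕ) : ℝ) + α) / 2) * (1 + ∑ i, v i ^ 2) ^ (-(((m + 1 : ℕ) : ℝ) + α) / 2) := by
    intro v
    have : 0 ≤ ∑ i, v i ^ 2 := Finset.sum_nonneg fun i _ => sq_nonneg _
    rw [← Real.mul_rpow hs.le (by positivity)]
    congr 1
    simp [mul_pow, Real.sq_sqrt hs.le, mul_add, Finset.mul_sum]
  simp only [h1] at h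
  rw [integral_const_mul] at h
  have hq : Real.sqrt s ^ m = s ^ ((m : ℝ) / 2) := by
    rw [Real.sqrt_eq_rpow, ← Real.rpow_natCast, ← Real.rpow_mul hs.le]; congr 1; ring
  have hpos : 0 < s ^ ((m : ℝ) / 2) := by positivity
  rw [Module.finrank_fin_fun, hq, abs_of_pos (by positivity), smul_eq_mul] at h
  have : s ^ (-(1 + α) / 2) = s ^ ((m : ℝ) / 2) * s ^ (-(((m + 1 : ℕ) : ℝ) + α) / 2) := by
    rw [← Real.rpow_add hs]; congr 1; push_cast; ring
  rw [this, mul_assoc, h]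
  field_simp

lemma marg (m : ℕ) (α : ℝ) (δ : ℝ) (hδ : 0 < δ)
    (hint : Integrable (fun z : EuclideanSpace ℝ (Fin (m+1)) =>
      (‖z‖ ^ 2 + δ) ^ (-(((m + 1 : ℕ) : ℝ) + α) / 2)))
    (F : ℝ → ℝ) (hF : Continuous F) (C : ℝ) (hC : ∀ t, |F t| ≤ C)
    (e : EuclideanSpace ℝ (Fin (m+1))) (he : ‖e‖ = 1) :
    ∫ z : EuclideanSpace ℝ (Fin (m+1)), (‖z‖ ^ 2 + δ) ^ (-(((m + 1 : ℕ) : ℝ) + α) / 2) * F (inner ℝ e z)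
    = (∫ v : Fin m → ℝ, (1 + ∑ i, v i ^ 2) ^ (-(((m + 1 : ℕ) : ℝ) + α) / 2)) *
      ∫ t : ℝ, (t ^ 2 + δ) ^ (-(1 + α) / 2) * F t := by
  set e0 : EuclideanSpace ℝ (Fin (m+1)) := EuclideanSpace.single 0 1 with he0
  set T := (Submodule.span ℝ {e0 - e})ᗮ.reflection with hT
  have hTe : T e0 = e := Submodule.reflection_sub (by simp [he0, he])
  set p := (-(((m + 1 : ℕ) : ℝ) + α) / 2) with hp
  set f : EuclideanSpace ℝ (Fin (m+1)) → ℝ := fun z => (‖z‖ ^ 2 + δ) ^ p * F (z 0) with hf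
  have hfi : Integrable f := by
    refine hint.mul_bdd (c := C) ?_ (ae_of_all _ fun z => by simpa using hC _)
    exact (hF.comp (by fun_prop)).aestronglyMeasurable
  have h1 : ∫ z : EuclideanSpace ℝ (Fin (m+1)), (‖z‖ ^ 2 + δ) ^ p * F (inner ℝ e z) = ∫ z, f z := by
    rw [← T.measurePreserving.integral_comp T.toHomeomorph.measurableEmbedding]
    refine integral_congr_ae (ae_of_all _ fun z => ?_)
    simp only [hf, LinearIsometryEquiv.norm_map]
    rw [← hTe, LinearIsometryEquiv.inner_map_map, he0, EuclideanSpace.inner_single_left]; simp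
  rw [h1]
  have mp1 := PiLp.volume_preserving_toLp (Fin (m+1))
  have mp2 := (volume_preserving_piFinSuccAbove (fun _ : Fin (m+1) => ℝ) 0).symm
  have mp := mp1.comp mp2
  have emb : MeasurableEmbedding (WithLp.toLp 2 ∘ (MeasurableEquiv.piFinSuccAbove (fun _ : Fin (m+1) => ℝ) 0).symm) :=
    (MeasurableEquiv.toLp 2 (Fin (m+1) → ℝ)).measurableEmbedding.comp (MeasurableEquiv.measurableEmbedding _)
  have hfi2 := (mp.integrable_comp_emb emb).2 hfi
  rw [← mp.integral_comp emb]
  have key : ∀ q : ℝ × (Fin m → ℝ), f ((WithLp.toLp 2 ∘ (MeasurableEquiv.piFinSuccAbove (fun _ : Fin (m+1) => ℝ) 0).symm) q)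
     = ((q.1 ^ 2 + δ) + ∑ i, q.2 i ^ 2) ^ p * F q.1 := by
    rintro ⟨t, v⟩
    simp only [hf, EuclideanSpace.norm_sq_eq, Fin.sum_univ_succ]
    simp [MeasurableEquiv.piFinSuccAbove]
    left; congr 1; ring
  have hfi3 := hfi2.congr (ae_of_all _ key)
  rw [integral_congr_ae (ae_of_all _ key)]
  rw [Measure.volume_eq_prod, integral_prod _ hfi3, ← integral_const_mul]
  refine integral_congr_ae (ae_of_all _ fun t => ?_)
  simp only
  rw [integral_mul_const, marg_scale m α _ (by positivity)]
  ring

lemma sym_bound {E : Type*} [NormedAddCommGroup E] [InnerProductSpace ℝ E] [FiniteDimensional ℝ E]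
    [MeasurableSpace E] [BorelSpace E] (q : ℝ → ℝ) (hq : AntitoneOn q (Ici 0))
    (hqi : Integrable (fun z : E => q ‖z‖))
    (θ : E → ℝ) (hθ : Continuous θ) (M : ℝ) (hM : ∀ z, |θ z| ≤ M)
    (Ψ : ℝ → ℝ) (hΨ : Continuous Ψ) (hodd : ∀ t, Ψ (-t) = - Ψ t) (C : ℝ) (hC : ∀ t, |Ψ t| ≤ C)
    (hmod : ∀ z w, |θ z - θ w| ≤ Ψ ‖z - w‖)
    (x y e : E) (ξ : ℝ) (hξ : 0 < ξ) (he : ‖e‖ = 1) (hxy : x - y = ξ • e) :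
    (∫ z, q ‖z‖ * θ (x - z)) - ∫ z, q ‖z‖ * θ (y - z) ≤
      ∫ z, q ‖z‖ * Ψ (ξ + 2 * inner ℝ e z) := by
  set ρ := (Submodule.span ℝ {e})ᗮ.reflection with hρ
  have ρf : ∀ u, ρ u = u - (2 * inner ℝ e u) • e := by
    intro u
    rw [hρ, Submodule.reflection_orthogonal_apply, Submodule.reflection_singleton_apply]
    simp [he, two_smul, add_smul, two_mul]
  have ρρ : ∀ u, ρ (ρ u) = u := fun u => Submodule.reflection_reflection _ u
  have hee : inner ℝ e e = (1 : ℝ) := by rw [real_inner_self_eq_norm_sq, he]; norm_num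
  set a : E := (ξ / 2) • e with ha
  set m : E := x - a with hm
  have hx : x = m + a := by simp [hm]
  have hy : y = m - a := by
    have : ξ • e = a + a := by rw [ha, ← add_smul]; congr 1; ring
    have h2 : y = x - (a + a) := by rw [← this, ← hxy]; abel
    rw [h2, hm]; abel
  have ρa : ρ a = -a := by
    rw [ρf, ha, inner_smul_right, hee, ← sub_smul, ← neg_smul]; congr 1; ring
  have mpρ := ρ.measurePreserving
  have embρ := ρ.toHomeomorph.measurableEmbedding
  -- integrability
  have iq : Integrable (fun u : E => q ‖a - u‖) := hqi.comp_sub_left a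
  have iq' : Integrable (fun u : E => q ‖a + u‖) := hqi.comp_add_left a
  have ib : ∀ (k g : E → ℝ) (K : ℝ), Integrable k → Continuous g → (∀ u, |g u| ≤ K) →
      Integrable (fun u => k u * g u) := fun k g K hk hg hK =>
    hk.mul_bdd (c := K) hg.aestronglyMeasurable (ae_of_all _ fun z => by simpa using hK z)
  set g : E → ℝ := fun u => θ (m + u) - θ (m + ρ u) with hg
  have gc : Continuous g := by
    have := ρ.continuous
    fun_prop
  have gb : ∀ u, |g u| ≤ M + M := fun u => (abs_sub _ _).trans (add_le_add (hM _) (hM _))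
  have gρ : ∀ u, g (ρ u) = - g u := fun u => by simp only [hg, ρρ]; ring
  set S : E → ℝ := fun u => Ψ (2 * inner ℝ e u) with hS
  have Sc : Continuous S := by fun_prop
  have D1 : (∫ z, q ‖z‖ * θ (x - z)) = ∫ u, q ‖a - u‖ * θ (m + u) := by
    rw [← integral_sub_left_eq_self (fun z : E => q ‖z‖ * θ (x - z)) volume a]
    refine integral_congr_ae (ae_of_all _ fun u => ?_)
    simp only; congr 2; rw [hx]; abel
  have D2 : (∫ z, q ‖z‖ * θ (y - z)) = ∫ u, q ‖a - u‖ * θ (m + ρ u) := by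
    rw [← integral_sub_left_eq_self (fun z : E => q ‖z‖ * θ (y - z)) volume (-a),
      ← mpρ.integral_comp embρ]
    refine integral_congr_ae (ae_of_all _ fun u => ?_)
    simp only
    have h1 : -a - ρ u = ρ (a - u) := by rw [map_sub, ρa]
    rw [h1, LinearIsometryEquiv.norm_map]
    congr 2; rw [← h1, hy]; abel
  have Deq : (∫ z, q ‖z‖ * θ (x - z)) - (∫ z, q ‖z‖ * θ (y - z)) = ∫ u, q ‖a - u‖ * g u := by
    rw [D1, D2, ← integral_sub]
    · simp only [hg, mul_sub]
    · exact ib _ _ M iq (by fun_prop) fun u => hM _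
    · exact ib _ _ M iq (by have := ρ.continuous; fun_prop) fun u => hM _
  have Deq2 : ∫ u, q ‖a - u‖ * g u = - ∫ u, q ‖a + u‖ * g u := by
    rw [← mpρ.integral_comp embρ, ← integral_neg]
    refine integral_congr_ae (ae_of_all _ fun u => ?_)
    simp only [gρ]
    have h1 : a - ρ u = ρ (-(a + u)) := by rw [map_neg, map_add, ρa]; abel
    rw [h1, LinearIsometryEquiv.norm_map, norm_neg]; ring
  have Seq : ∫ u, q ‖a + u‖ * S u = - ∫ u, q ‖a - u‖ * S u := by
    rw [← integral_neg_eq_self (fun u : E => q ‖a + u‖ * S u), ← integral_neg]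
    refine integral_congr_ae (ae_of_all _ fun u => ?_)
    simp only [hS, inner_neg_right, mul_neg, hodd, sub_eq_add_neg]
  have Send : ∫ u, q ‖a - u‖ * S u = ∫ z, q ‖z‖ * Ψ (ξ + 2 * inner ℝ e z) := by
    rw [← integral_add_left_eq_self (fun u : E => q ‖a - u‖ * S u) a]
    refine integral_congr_ae (ae_of_all _ fun u => ?_)
    simp only [hS, inner_add_right, ha, inner_smul_right, hee]
    congr 2
    · rw [← norm_neg]; congr 1; abel
    · ring
  have pt : ∀ u, (q ‖a - u‖ - q ‖a + u‖) * g u ≤ (q ‖a - u‖ - q ‖a + u‖) * S u := by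
    intro u
    have hn : ‖u - ρ u‖ = 2 * |inner ℝ e u| := by
      rw [ρf, sub_sub_cancel, norm_smul, he]; simp
    have hb : |g u| ≤ Ψ (2 * |inner ℝ e u|) := by
      rw [← hn]; have := hmod (m + u) (m + ρ u)
      rwa [add_sub_add_left_eq_sub] at this
    have e1 : ‖a - u‖ ^ 2 = ‖a‖ ^ 2 - ξ * inner ℝ e u + ‖u‖ ^ 2 := by
      rw [norm_sub_sq_real, ha, inner_smul_left]; simp; ring
    have e2 : ‖a + u‖ ^ 2 = ‖a‖ ^ 2 + ξ * inner ℝ e u + ‖u‖ ^ 2 := by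
      rw [norm_add_sq_real, ha, inner_smul_left]; simp; ring
    rcases le_total 0 (inner ℝ e u : ℝ) with h | h
    · have : ‖a - u‖ ≤ ‖a + u‖ := by
        refine le_of_sq_le_sq ?_ (norm_nonneg _)
        rw [e1, e2]; nlinarith
      have := hq (norm_nonneg _) (norm_nonneg _) this
      refine mul_le_mul_of_nonneg_left ?_ (by linarith)
      rw [abs_of_nonneg h] at hb
      exact (le_abs_self _).trans hb
    · have : ‖a + u‖ ≤ ‖a - u‖ := by
        refine le_of_sq_le_sq ?_ (norm_nonneg _)
        rw [e1, e2]; nlinarith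
      have := hq (norm_nonneg _) (norm_nonneg _) this
      refine mul_le_mul_of_nonpos_left ?_ (by linarith)
      rw [abs_of_nonpos h, mul_neg, hodd] at hb
      have := (neg_le_abs (g u)).trans hb
      simp only [hS]; linarith
  have Sb : ∀ u, |S u| ≤ C := fun u => hC _
  have fin := integral_mono (μ := volume) (ib _ g _ (iq.sub iq') gc gb) (ib _ S _ (iq.sub iq') Sc Sb) pt
  simp only [Pi.sub_apply, sub_mul] at fin
  rw [integral_sub (ib _ g _ iq gc gb) (ib _ g _ iq' gc gb),
    integral_sub (ib _ S _ iq Sc Sb) (ib _ S _ iq' Sc Sb)] at fin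
  rw [Deq, ← Send]
  linarith

lemma kint (α δ : ℝ) (hα : 0 < α) (hδ : 0 < δ) :
    Integrable (fun t : ℝ => (t ^ 2 + δ) ^ (-(1 + α) / 2)) := by
  have h := (integrable_rpow_neg_one_add_norm_sq (E := ℝ) (μ := volume)
    (r := 1 + α) (by simp; linarith)).const_mul ((min 1 δ) ^ (-(1 + α) / 2))
  have hm : 0 < min 1 δ := by positivity
  refine h.mono' (by apply Measurable.aestronglyMeasurable; fun_prop) (ae_of_all _ fun t => ?_)
  rw [Real.norm_of_nonneg (by positivity), ← Real.mul_rpow hm.le (by positivity)]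
  refine Real.rpow_le_rpow_of_nonpos (by positivity) ?_ (by linarith)
  simp
  nlinarith [min_le_left 1 δ, min_le_right 1 δ, sq_nonneg t]

lemma rfac (α δ t : ℝ) (hδ : 0 ≤ δ) (ht : 0 < t) :
    t ^ (1 + α) * (t ^ 2 + δ) ^ (-(1 + α) / 2) = (t ^ 2 / (t ^ 2 + δ)) ^ ((1 + α) / 2) := by
  rw [Real.div_rpow (by positivity) (by positivity), neg_div, Real.rpow_neg (by positivity),
    ← div_eq_mul_inv, ← Real.rpow_natCast t 2, ← Real.rpow_mul ht.le]
  congr 2; push_cast; ring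

lemma rfac_le (α δ t : ℝ) (hα : 0 < α) (hδ : 0 ≤ δ) (ht : 0 < t) :
    |t ^ (1 + α) * (t ^ 2 + δ) ^ (-(1 + α) / 2)| ≤ 1 := by
  rw [abs_of_nonneg (by positivity), rfac α δ t hδ ht]
  refine Real.rpow_le_one (by positivity) ?_ (by linarith)
  rw [div_le_one (by positivity)]; linarith

lemma trunc_int (α : ℝ) (hα : 0 < α) (s : Set ℝ) (hs : MeasurableSet s) (hs0 : ∀ t ∈ s, 0 < t)
    (G : ℝ → ℝ) (hG : IntegrableOn (fun t => G t / t ^ (1 + α)) s) (δ : ℝ) (hδ : 0 < δ) :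
    IntegrableOn (fun t => (t ^ 2 + δ) ^ (-(1 + α) / 2) * G t) s := by
  have h : IntegrableOn (fun t => (G t / t ^ (1 + α)) * (t ^ (1 + α) * (t ^ 2 + δ) ^ (-(1 + α) / 2))) s := by
    refine Integrable.mul_bdd (c := 1) hG (by apply Measurable.aestronglyMeasurable; fun_prop) ?_
    filter_upwards [ae_restrict_mem hs] with t ht
    exact rfac_le α δ t hα hδ.le (hs0 t ht)
  refine h.congr_fun (fun t ht => ?_) hs
  have := Real.rpow_pos_of_pos (hs0 t ht) (1 + α)
  simp only; field_simp

lemma trunc_lim (α : ℝ) (hα : 0 < α) (s : Set ℝ) (hs : MeasurableSet s) (hs0 : ∀ t ∈ s, 0 < t)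
    (G : ℝ → ℝ) (hG : IntegrableOn (fun t => G t / t ^ (1 + α)) s) (δ : ℝ → ℝ)
    (hδ : ∀ h, 0 < h → 0 < δ h) (hl : Tendsto δ (nhdsWithin 0 (Ioi 0)) (nhds 0)) :
    Tendsto (fun h => ∫ t in s, (t ^ 2 + δ h) ^ (-(1 + α) / 2) * G t) (nhdsWithin 0 (Ioi 0))
      (nhds (∫ t in s, G t / t ^ (1 + α))) := by
  refine tendsto_integral_filter_of_dominated_convergence (fun t => |G t / t ^ (1 + α)|) ?_ ?_ hG.abs ?_
  · filter_upwards [self_mem_nhdsWithin] with h hh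
    exact (trunc_int α hα s hs hs0 G hG _ (hδ h hh)).aestronglyMeasurable
  · filter_upwards [self_mem_nhdsWithin] with h hh
    filter_upwards [ae_restrict_mem hs] with t ht
    have h0 := Real.rpow_pos_of_pos (hs0 t ht) (1 + α)
    have h1 := rfac_le α (δ h) t hα (hδ h hh).le (hs0 t ht)
    have h2 : (t ^ 2 + δ h) ^ (-(1 + α) / 2) * G t =
      (G t / t ^ (1 + α)) * (t ^ (1 + α) * (t ^ 2 + δ h) ^ (-(1 + α) / 2)) := by field_simp
    rw [h2, Real.norm_eq_abs, abs_mul]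
    exact mul_le_of_le_one_right (abs_nonneg _) h1
  · filter_upwards [ae_restrict_mem hs] with t ht
    have ht := hs0 t ht
    have h3 : Tendsto (fun h => (t ^ 2 + δ h) ^ (-(1 + α) / 2) * G t) (nhdsWithin 0 (Ioi 0))
        (nhds ((t ^ 2 + 0) ^ (-(1 + α) / 2) * G t)) :=
      (Tendsto.rpow_const (hl.const_add _) (Or.inl (by positivity))).mul_const _
    convert h3 using 2
    have h4 := rfac α 0 t le_rfl ht
    have h5 : 0 < t ^ 2 := by positivity
    have h0 := Real.rpow_pos_of_pos ht (1 + α)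
    rw [add_zero, div_self h5.ne', Real.one_rpow] at h4
    rw [add_zero, div_eq_iff h0.ne']
    linear_combination -(G t) * h4

lemma step (m : ℕ) (α : ℝ) (hα1 : 0 < α) (ω : ℝ → ℝ) (hmono : MonotoneOn ω (Ici 0))
    (hcont : ContinuousOn ω (Ici 0)) (h0 : ω 0 = 0)
    (θ : EuclideanSpace ℝ (Fin (m+1)) → ℝ) (M : ℝ) (hθ : Continuous θ) (hM : ∀ z, |θ z| ≤ M)
    (hmod : ∀ z w, |θ z - θ w| ≤ ω ‖z - w‖) (C δ : ℝ) (hC : 0 < C) (hδ : 0 < δ)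
    (hnorm : ∫ z : EuclideanSpace ℝ (Fin (m+1)),
      C / (‖z‖ ^ 2 + δ) ^ ((((m+1 : ℕ) : ℝ) + α) / 2) = 1)
    (x y : EuclideanSpace ℝ (Fin (m+1))) (ξ : ℝ) (hxy : x ≠ y) (hξ : ‖x - y‖ = ξ)
    (i1 : IntegrableOn (fun η => (ω (ξ + 2 * η) + ω (ξ - 2 * η) - 2 * ω ξ) / η ^ (1 + α))
          (Ioc 0 (ξ / 2)))
    (i2 : IntegrableOn (fun η => (ω (2 * η + ξ) - ω (2 * η - ξ) - 2 * ω ξ) / η ^ (1 + α))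
          (Ioi (ξ / 2))) :
    (∫ z, (C / (‖z‖ ^ 2 + δ) ^ ((((m+1 : ℕ) : ℝ) + α) / 2)) * θ (x - z))
    - (∫ z, (C / (‖z‖ ^ 2 + δ) ^ ((((m+1 : ℕ) : ℝ) + α) / 2)) * θ (y - z)) - ω ξ ≤
    C * (∫ v : Fin m → ℝ, (1 + ∑ i, v i ^ 2) ^ (-(((m + 1 : ℕ) : ℝ) + α) / 2)) *
     ((∫ t in Ioc 0 (ξ / 2), (t ^ 2 + δ) ^ (-(1 + α) / 2) * (ω (ξ + 2 * t) + ω (ξ - 2 * t) - 2 * ω ξ)) +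
     ∫ t in Ioi (ξ / 2), (t ^ 2 + δ) ^ (-(1 + α) / 2) * (ω (2 * t + ξ) - ω (2 * t - ξ) - 2 * ω ξ)) := by
  have hξ0 : 0 < ξ := by rw [← hξ]; exact norm_pos_iff.2 (sub_ne_zero.2 hxy)
  have hM0 : 0 ≤ M := (abs_nonneg _).trans (hM 0)
  have hωn : ∀ t, 0 ≤ t → 0 ≤ ω t := fun t ht => h0 ▸ hmono (mem_Ici.2 le_rfl) ht ht
  set W : ℝ → ℝ := fun t => min (ω (max t 0)) (2 * M) with hW
  have Wc : Continuous W :=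
    (hcont.comp_continuous (by fun_prop) fun t => le_max_right t 0).min continuous_const
  have W0 : ∀ t, t ≤ 0 → W t = 0 := fun t ht => by
    simp only [hW, max_eq_right ht, h0]; exact min_eq_left (by linarith)
  have Wp : ∀ t, 0 ≤ t → W t = min (ω t) (2 * M) := fun t ht => by simp only [hW, max_eq_left ht]
  have Wn : ∀ t, 0 ≤ W t := fun t => le_min (hωn _ (le_max_right _ _)) (by linarith)
  have Wb : ∀ t, W t ≤ 2 * M := fun t => min_le_right _ _
  set Ψ : ℝ → ℝ := fun t => W t - W (-t) with hΨ
  have Ψc : Continuous Ψ := by fun_prop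
  have Ψo : ∀ t, Ψ (-t) = - Ψ t := fun t => by simp only [hΨ, neg_neg]; ring
  have Ψb : ∀ t, |Ψ t| ≤ 2 * M := fun t => by
    rw [abs_le]; have := Wn t; have := Wn (-t); have := Wb t; have := Wb (-t)
    constructor <;> simp only [hΨ] <;> linarith
  have Ψp : ∀ t, 0 ≤ t → Ψ t = min (ω t) (2 * M) := fun t ht => by
    simp only [hΨ]; rw [W0 (-t) (by linarith), Wp t ht, sub_zero]
  set e := ξ⁻¹ • (x - y) with he
  have he1 : ‖e‖ = 1 := by rw [he, norm_smul, hξ]; simp [abs_of_pos hξ0, hξ0.ne']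
  have hxe : x - y = ξ • e := by rw [he, smul_smul, mul_inv_cancel₀ hξ0.ne', one_smul]
  set q : ℝ → ℝ := fun r => C / (r ^ 2 + δ) ^ ((((m+1 : ℕ) : ℝ) + α) / 2) with hq
  have hqa : AntitoneOn q (Ici 0) := by
    intro r hr s hs hrs
    have hr : 0 ≤ r := hr
    simp only [hq]
    gcongr
  have hqi : Integrable (fun z : EuclideanSpace ℝ (Fin (m+1)) => q ‖z‖) := by
    by_contra hcon
    have := integral_undef hcon
    simp only [hq] at this
    rw [this] at hnorm; norm_num at hnorm
  have hqk : ∀ r, q r = C * (r ^ 2 + δ) ^ (-(((m + 1 : ℕ) : ℝ) + α) / 2) := fun r => by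
    simp only [hq]; rw [neg_div, Real.rpow_neg (by positivity), div_eq_mul_inv]
  have A := sym_bound q hqa hqi θ hθ M hM Ψ Ψc Ψo (2 * M) Ψb (fun z w => by
    rw [Ψp _ (norm_nonneg _)]
    refine le_min (hmod z w) ((abs_sub _ _).trans ?_)
    have := hM z; have := hM w; linarith) x y e ξ hξ0 he1 hxe
  set F : ℝ → ℝ := fun t => Ψ (ξ + 2 * t) + Ψ (ξ - 2 * t) - 2 * ω ξ with hF
  have Fc : Continuous F := by fun_prop
  have Fb : ∀ t, |F t| ≤ 4 * M + 2 * |ω ξ| := fun t => by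
    have h1 := abs_le.1 (Ψb (ξ + 2 * t)); have h2 := abs_le.1 (Ψb (ξ - 2 * t))
    have := neg_abs_le (ω ξ); have := le_abs_self (ω ξ)
    rw [abs_le]; constructor <;> simp only [hF] <;> linarith [h1.1, h1.2, h2.1, h2.2]
  have Bneg : ∫ z, q ‖z‖ * Ψ (ξ - 2 * inner ℝ e z) = ∫ z, q ‖z‖ * Ψ (ξ + 2 * inner ℝ e z) := by
    rw [← integral_neg_eq_self]
    refine integral_congr_ae (ae_of_all _ fun z => ?_)
    simp only [norm_neg, inner_neg_right, mul_neg, sub_neg_eq_add]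
  have ib : ∀ (g : EuclideanSpace ℝ (Fin (m+1)) → ℝ) (K : ℝ), Continuous g → (∀ u, |g u| ≤ K) →
      Integrable (fun u => q ‖u‖ * g u) := fun g K hg hK =>
    hqi.mul_bdd (c := K) hg.aestronglyMeasurable (ae_of_all _ fun z => by simpa using hK z)
  have B : ∫ z, q ‖z‖ * F (inner ℝ e z) = 2 * (∫ z, q ‖z‖ * Ψ (ξ + 2 * inner ℝ e z)) - 2 * ω ξ := by
    have e1 : ∀ z : EuclideanSpace ℝ (Fin (m+1)), q ‖z‖ * F (inner ℝ e z) =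
       (q ‖z‖ * Ψ (ξ + 2 * inner ℝ e z) + q ‖z‖ * Ψ (ξ - 2 * inner ℝ e z)) - q ‖z‖ * (2 * ω ξ) := by
      intro z; simp only [hF]; ring
    simp only [e1]
    have j1 := ib (fun z => Ψ (ξ + 2 * inner ℝ e z)) _ (by fun_prop) (fun z => Ψb _)
    have j2 := ib (fun z => Ψ (ξ - 2 * inner ℝ e z)) _ (by fun_prop) (fun z => Ψb _)
    have j3 : Integrable (fun z => q ‖z‖ * Ψ (ξ + 2 * inner ℝ e z) + q ‖z‖ * Ψ (ξ - 2 * inner ℝ e z)) := j1.add j2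
    rw [integral_sub j3 (hqi.mul_const _), integral_add j1 j2, Bneg, integral_mul_const]
    simp only [hq]; rw [hnorm]; ring
  have hki : Integrable (fun z : EuclideanSpace ℝ (Fin (m+1)) =>
      (‖z‖ ^ 2 + δ) ^ (-(((m + 1 : ℕ) : ℝ) + α) / 2)) := by
    refine (hqi.const_mul C⁻¹).congr (ae_of_all _ fun z => ?_)
    simp only [hqk]; field_simp
  have Mg := marg m α δ hδ hki F Fc _ Fb e he1
  simp only [hqk, mul_assoc] at B
  rw [integral_const_mul, integral_const_mul, Mg] at B
  simp only [hqk, mul_assoc] at A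
  simp only [integral_const_mul] at A
  have Fe : ∀ t, F |t| = F t := fun t => by
    rcases abs_choice t with h | h <;> rw [h]
    simp only [hF, mul_neg, sub_neg_eq_add]; ring_nf
  have habs : ∫ t : ℝ, (t ^ 2 + δ) ^ (-(1 + α) / 2) * F t =
      2 * ∫ t in Ioi (0:ℝ), (t ^ 2 + δ) ^ (-(1 + α) / 2) * F t := by
    rw [← integral_comp_abs]; simp only [sq_abs, Fe]
  have kF : Integrable (fun t : ℝ => (t ^ 2 + δ) ^ (-(1 + α) / 2) * F t) :=
    (kint α δ hα1 hδ).mul_bdd (c := 4 * M + 2 * |ω ξ|) Fc.aestronglyMeasurable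
      (ae_of_all _ fun t => by simpa using Fb t)
  have hu : Ioi (0:ℝ) = Ioc 0 (ξ / 2) ∪ Ioi (ξ / 2) := (Ioc_union_Ioi_eq_Ioi (by positivity)).symm
  have hsplit : ∫ t in Ioi (0:ℝ), (t ^ 2 + δ) ^ (-(1 + α) / 2) * F t =
     (∫ t in Ioc 0 (ξ / 2), (t ^ 2 + δ) ^ (-(1 + α) / 2) * F t) +
      ∫ t in Ioi (ξ / 2), (t ^ 2 + δ) ^ (-(1 + α) / 2) * F t := by
    rw [hu, setIntegral_union (Ioc_disjoint_Ioi le_rfl) measurableSet_Ioi kF.integrableOn kF.integrableOn]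
  have c1 : (∫ t in Ioc 0 (ξ / 2), (t ^ 2 + δ) ^ (-(1 + α) / 2) * F t) ≤
      ∫ t in Ioc 0 (ξ / 2), (t ^ 2 + δ) ^ (-(1 + α) / 2) * (ω (ξ + 2 * t) + ω (ξ - 2 * t) - 2 * ω ξ) := by
    refine setIntegral_mono_on kF.integrableOn
      (trunc_int α hα1 _ measurableSet_Ioc (fun t ht => ht.1) _ i1 δ hδ) measurableSet_Ioc fun t ht => ?_
    refine mul_le_mul_of_nonneg_left ?_ (by positivity)
    have := ht.1; have := ht.2
    simp only [hF]
    rw [Ψp _ (by linarith), Ψp _ (by linarith)]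
    linarith [min_le_left (ω (ξ + 2 * t)) (2 * M), min_le_left (ω (ξ - 2 * t)) (2 * M)]
  have c2 : (∫ t in Ioi (ξ / 2), (t ^ 2 + δ) ^ (-(1 + α) / 2) * F t) ≤
      ∫ t in Ioi (ξ / 2), (t ^ 2 + δ) ^ (-(1 + α) / 2) * (ω (2 * t + ξ) - ω (2 * t - ξ) - 2 * ω ξ) := by
    refine setIntegral_mono_on kF.integrableOn
      (trunc_int α hα1 _ measurableSet_Ioi (fun t ht => lt_trans (by positivity) (mem_Ioi.1 ht)) _ i2 δ hδ)
      measurableSet_Ioi fun t ht => ?_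
    refine mul_le_mul_of_nonneg_left ?_ (by positivity)
    have ht : ξ / 2 < t := ht
    simp only [hF]
    have e3 : ξ - 2 * t = -(2 * t - ξ) := by ring
    rw [e3, Ψo, Ψp _ (by linarith), Ψp _ (by linarith), add_comm ξ]
    have hm := hmono (a := 2 * t - ξ) (b := 2 * t + ξ) (mem_Ici.2 (by linarith)) (mem_Ici.2 (by linarith)) (by linarith)
    rcases min_cases (ω (2 * t + ξ)) (2 * M) with ⟨a1, a2⟩ | ⟨a1, a2⟩ <;>
    rcases min_cases (ω (2 * t - ξ)) (2 * M) with ⟨b1, b2⟩ | ⟨b1, b2⟩ <;> linarith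
  have Kp := marg_pos m α hα1
  set K := ∫ v : Fin m → ℝ, (1 + ∑ i, v i ^ 2) ^ (-(((m + 1 : ℕ) : ℝ) + α) / 2) with hK
  have c3 := mul_le_mul_of_nonneg_left (add_le_add c1 c2) (mul_pos hC Kp).le
  refine le_trans ?_ c3
  rw [← hsplit]
  rw [habs] at B
  change (∫ z, q ‖z‖ * θ (x - z)) - (∫ z, q ‖z‖ * θ (y - z)) - ω ξ ≤ _
  simp only [hqk, mul_assoc]
  simp only [integral_const_mul]
  linarith

/-- Action of −|D|^α (defined through the semigroup kernel
P_h(x) = c h/(|x|² + α² h^{2/α})^{(n+α)/2}) on a function with modulus of continuity ω,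
evaluated at two points realizing the modulus. -/
theorem stmt_7 (n : ℕ) (hn : 1 ≤ n) (α : ℝ) (hα1 : 0 < α) (hα2 : α < 2) :
    ∃ B > 0, ∀ ω : ℝ → ℝ, ConcaveOn ℝ (Ici 0) ω → MonotoneOn ω (Ici 0) →
      ContinuousOn ω (Ici 0) → ω 0 = 0 →
      ∀ (θ : EuclideanSpace ℝ (Fin n) → ℝ) (M : ℝ), ContDiff ℝ (⊤ : ℕ∞) θ → (∀ z, |θ z| ≤ M) →
        (∀ z w, |θ z - θ w| ≤ ω ‖z - w‖) →
      ∀ c : ℝ, 0 < c →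
        (∀ h : ℝ, 0 < h → ∫ z : EuclideanSpace ℝ (Fin n),
            c * h / (‖z‖ ^ 2 + α ^ 2 * h ^ (2 / α)) ^ (((n : ℝ) + α) / 2) = 1) →
      ∀ (x y : EuclideanSpace ℝ (Fin n)) (ξ Lx Ly : ℝ),
        x ≠ y → ‖x - y‖ = ξ → θ x - θ y = ω ξ →
        Tendsto (fun h : ℝ =>
            ((∫ z, (c * h / (‖z‖ ^ 2 + α ^ 2 * h ^ (2 / α)) ^ (((n : ℝ) + α) / 2)) *
              θ (x - z)) - θ x) / h) (nhdsWithin 0 (Ioi 0)) (nhds Lx) →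
        Tendsto (fun h : ℝ =>
            ((∫ z, (c * h / (‖z‖ ^ 2 + α ^ 2 * h ^ (2 / α)) ^ (((n : ℝ) + α) / 2)) *
              θ (y - z)) - θ y) / h) (nhdsWithin 0 (Ioi 0)) (nhds Ly) →
        IntegrableOn (fun η => (ω (ξ + 2 * η) + ω (ξ - 2 * η) - 2 * ω ξ) / η ^ (1 + α))
          (Ioc 0 (ξ / 2)) →
        IntegrableOn (fun η => (ω (2 * η + ξ) - ω (2 * η - ξ) - 2 * ω ξ) / η ^ (1 + α))
          (Ioi (ξ / 2)) →
        Lx - Ly ≤ B *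
          ((∫ η in Ioc 0 (ξ / 2), (ω (ξ + 2 * η) + ω (ξ - 2 * η) - 2 * ω ξ) / η ^ (1 + α)) +
           ∫ η in Ioi (ξ / 2), (ω (2 * η + ξ) - ω (2 * η - ξ) - 2 * ω ξ) / η ^ (1 + α)) := by
  obtain ⟨m, rfl⟩ : ∃ m, n = m + 1 := ⟨n - 1, by omega⟩
  have Kp := marg_pos m α hα1
  set K := ∫ v : Fin m → ℝ, (1 + ∑ i, v i ^ 2) ^ (-(((m + 1 : ℕ) : ℝ) + α) / 2) with hK
  set J := ∫ z : EuclideanSpace ℝ (Fin (m+1)),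
    1 / (‖z‖ ^ 2 + α ^ 2) ^ ((((m + 1 : ℕ) : ℝ) + α) / 2) with hJ
  refine ⟨if 0 < J then J⁻¹ * K else 1, by split_ifs with h <;> positivity, ?_⟩
  intro ω _ hmono hcont h0 θ M hθ hM hmod c hc hnorm x y ξ Lx Ly hxy hξ hval hLx hLy i1 i2
  have hcJ : c * J = 1 := by
    rw [← hnorm 1 one_pos, hJ, ← integral_const_mul]
    simp [div_eq_mul_inv]
  have hJp : 0 < J := by
    by_contra hcon
    nlinarith
  have hcJ' : J⁻¹ = c := by field_simp; linarith
  rw [if_pos hJp, hcJ']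
  have hξ0 : 0 < ξ := by rw [← hξ]; exact norm_pos_iff.2 (sub_ne_zero.2 hxy)
  have hδ : ∀ h : ℝ, 0 < h → 0 < α ^ 2 * h ^ (2 / α) := fun h hh => by positivity
  have hl : Tendsto (fun h : ℝ => α ^ 2 * h ^ (2 / α)) (nhdsWithin 0 (Ioi 0)) (nhds 0) := by
    have h2 : 0 < 2 / α := by positivity
    have h1 : Tendsto (fun h : ℝ => α ^ 2 * h ^ (2 / α)) (nhds 0) (nhds (α ^ 2 * 0 ^ (2 / α))) :=
      ((Real.continuousAt_rpow_const 0 (2 / α) (Or.inr h2.le)).tendsto).const_mul _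
    rw [Real.zero_rpow h2.ne', mul_zero] at h1
    exact h1.mono_left nhdsWithin_le_nhds
  have l1 := trunc_lim α hα1 _ measurableSet_Ioc (fun t ht => ht.1) _ i1 _ hδ hl
  have l2 := trunc_lim α hα1 _ measurableSet_Ioi (fun t ht => lt_trans (by positivity) (mem_Ioi.1 ht)) _ i2 _ hδ hl
  refine le_of_tendsto_of_tendsto (hLx.sub hLy) ((l1.add l2).const_mul (c * K)) ?_
  filter_upwards [self_mem_nhdsWithin] with h hh
  have hh : 0 < h := hh
  have S := step m α hα1 ω hmono hcont h0 θ M hθ.continuous hM hmod (c * h) _ (by positivity) (hδ h hh)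
    (hnorm h hh) x y ξ hxy hξ i1 i2
  rw [← sub_div, div_le_iff₀ hh]
  rw [← hK] at S
  rw [← hval] at S ⊢
  linarith
end
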